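/- arXiv:1409.7214 — 2 statements merged into one kernel-verified Lean document; each statement's English description precedes it below -/
import Mathlib

section
/- Let γ = (a b; c d) ∈ SL₂(ℤ) with γ ≡ identity or (0 1; 1 0) modulo 2 (i.e. γ ∈ Γ_θ), c ≡ 0 (mod N), and d > 0. Then for N odd, θ_{N,h}^{(ε)}(γτ) = e^{πi a²bd h²/N} · υ(γ,N) · (cτ+d)^{1/2+ε} · θ_{N,ah}^{(ε)}(τ), where υ(γ,N) = ζ₈^{bN}·(d/|bN|) if d is even, and υ(γ,N) = ζ₈^{d−1}·(−bN/d) if d is odd, with (·/·) the Kronecker symbol and ζ₈ = e^{2πi/8}. -/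
open Complex

/-- The partial theta series `θ_{N,h}^{(ε)}(τ) = ∑_{n ≡ h (mod N)} n^ε e^{π i n² τ / N}`. -/
noncomputable def thetaPart (N : ℕ) (h : ℤ) (ε : ℕ) (τ : ℂ) : ℂ :=
  ∑' n : {n : ℤ // n ≡ h [ZMOD (N : ℤ)]},
    ((n : ℤ) : ℂ) ^ ε * Complex.exp (Real.pi * Complex.I * ((n : ℤ) : ℂ) ^ 2 * τ / N)

/-- The multiplier `υ(γ, N)`: `ζ₈^{bN} (d / |bN|)` for even `d`,
`ζ₈^{d-1} (-bN / d)` for odd `d`, where `(·/·)` is the Kronecker symbol. -/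
noncomputable def upsilonMult (b d : ℤ) (N : ℕ) : ℂ :=
  if Even d then
    Complex.exp (Real.pi * Complex.I / 4) ^ (b * N) * ((jacobiSym d (b * N).natAbs : ℤ) : ℂ)
  else
    Complex.exp (Real.pi * Complex.I / 4) ^ (d - 1) * ((jacobiSym (-(b * N)) d.natAbs : ℤ) : ℂ)

namespace jacobiSym

/-- The map `b ↦ (a / |b|)` on odd integers is invariant under translation by `4 * a`. -/
lemma natAbs_add_four_mul {a : ℤ} (ha : 0 < a) {b : ℤ} (hb : Odd b) :
    jacobiSym a (b + 4 * a).natAbs = jacobiSym a b.natAbs := by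
  obtain ⟨m, rfl⟩ := Int.eq_ofNat_of_zero_le ha.le
  have hsame (x : ℕ) (hx : Odd x) : jacobiSym m (x + 4 * m) = jacobiSym m x := by
    rw [jacobiSym.mod_right m (b := x + 4 * m) (by grind), jacobiSym.mod_right m hx]
    simp
  rcases le_or_gt 0 b with h | h
  · obtain ⟨x, rfl⟩ := Int.eq_ofNat_of_zero_le h
    have := hsame x (by exact_mod_cast hb)
    convert this using 2 <;> omega
  rcases le_or_gt (b + 4 * m) 0 with h' | h'
  · obtain ⟨x, hx⟩ := Int.eq_ofNat_of_zero_le (neg_nonneg.mpr h')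
    have := hsame x (by rw [← Int.odd_coe_nat]; grind)
    convert this.symm using 2 <;> omega
  · obtain ⟨x, hx⟩ := Int.eq_ofNat_of_zero_le (neg_nonneg.mpr h.le)
    obtain ⟨y, hy⟩ := Int.eq_ofNat_of_zero_le h'.le
    have hxo : Odd x := by rw [← Int.odd_coe_nat]; grind
    have hyo : Odd y := by rw [← Int.odd_coe_nat]; grind
    have hxy : (x : ℤ) + y = 4 * m := by omega
    have key (u v : ℕ) (hu : Odd u) (huv : (u : ℤ) + v = 4 * m) :
        jacobiSym m u = jacobiSym v u := by
      rw [← one_mul (jacobiSym m u), ← jacobiSym.at_four hu, ← jacobiSym.mul_left, ← huv]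
      exact jacobiSym.mod_left' (by simp)
    have e1 : (b + 4 * (m : ℤ)).natAbs = y := by omega
    have e2 : b.natAbs = x := by omega
    rw [e1, e2, key y x hyo (by omega), key x y hxo hxy]
    rcases Nat.odd_mod_four_iff.mp (Nat.odd_iff.mp hxo) with h4 | h4
    · exact jacobiSym.quadratic_reciprocity_one_mod_four h4 hyo
    · exact (jacobiSym.quadratic_reciprocity_one_mod_four (by omega) hxo).symm

lemma two_natAbs {b : ℤ} (hb : Odd b) : jacobiSym 2 b.natAbs = ZMod.χ₈ b := by
  rw [jacobiSym.at_two (Int.natAbs_odd.mpr hb), ZMod.χ₈_nat_eq_if_mod_eight,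
    ZMod.χ₈_int_eq_if_mod_eight]
  have := Int.odd_iff.mp hb
  split_ifs <;> first | rfl | omega

/-- Translating an odd `b` by `2 * (2 * m)` multiplies `(2 * m / |b|)` by `(-1) ^ m`. -/
lemma natAbs_add_two_mul {m : ℤ} (hm : 0 < m) {b : ℤ} (hb : Odd b) :
    jacobiSym (2 * m) (b + 2 * (2 * m)).natAbs =
      (if Even m then 1 else -1) * jacobiSym (2 * m) b.natAbs := by
  rw [jacobiSym.mul_left, jacobiSym.mul_left, show b + 2 * (2 * m) = b + 4 * m by ring,
    natAbs_add_four_mul hm hb, two_natAbs hb, two_natAbs (by grind),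
    ZMod.χ₈_int_eq_if_mod_eight, ZMod.χ₈_int_eq_if_mod_eight, ← mul_assoc]
  congr 1
  have := Int.odd_iff.mp hb
  by_cases h : Even m
  · obtain ⟨k, rfl⟩ := h
    have : (b + 4 * (k + k)) % 8 = b % 8 := by omega
    grind
  · obtain ⟨k, rfl⟩ := Int.not_even_iff_odd.mp h
    grind

end jacobiSym

lemma exp_pi_mul_I_div_four_zpow_four :
    Complex.exp (Real.pi * Complex.I / 4) ^ (4 : ℤ) = -1 := by
  rw [← Complex.exp_int_mul, ← Complex.exp_pi_mul_I]
  congr 1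
  push_cast
  ring

lemma exp_pi_mul_I_div_four_zpow_four_mul (k : ℤ) :
    Complex.exp (Real.pi * Complex.I / 4) ^ (4 * k) = ((if Even k then 1 else -1 : ℤ) : ℂ) := by
  rw [zpow_mul, exp_pi_mul_I_div_four_zpow_four]
  split_ifs with h
  · simp [h.neg_one_zpow]
  · simp [(Int.not_even_iff_odd.mp h).neg_one_zpow]

lemma upsilonMult_mul_natCast (b d : ℤ) (N : ℕ) :
    upsilonMult b d N = upsilonMult (b * N) d 1 := by
  simp [upsilonMult]

lemma upsilonMult_add_two_mul {b d : ℤ} (hd : 0 < d) (hbd : Odd (b + d)) :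
    upsilonMult (b + 2 * d) d 1 = upsilonMult b d 1 := by
  unfold upsilonMult
  simp only [Nat.cast_one, mul_one]
  split_ifs with h
  · obtain ⟨m, rfl⟩ := even_iff_two_dvd.mp h
    have hb : Odd b := by grind
    have hm : 0 < m := by omega
    rw [jacobiSym.natAbs_add_two_mul hm hb, zpow_add₀ (Complex.exp_ne_zero _),
      show 2 * (2 * m) = 4 * m by ring, exp_pi_mul_I_div_four_zpow_four_mul]
    split_ifs <;> push_cast <;> ring
  · congr 2
    apply jacobiSym.mod_left'
    have : (d.natAbs : ℤ) = d := by omega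
    rw [this, show -(b + 2 * d) = -b + d * (-2) by ring, Int.add_mul_emod_self_left]

lemma upsilonMult_eq_mul_upsilonMult_neg {b d : ℤ} (hd : 0 < d)
    (hbd : Odd (b + d)) :
    upsilonMult b d 1 = Complex.exp (Real.pi * Complex.I / 4) * upsilonMult (-d) b 1 := by
  unfold upsilonMult
  simp only [Nat.cast_one, mul_one, neg_neg, Int.natAbs_neg]
  have hz := Complex.exp_ne_zero (Real.pi * Complex.I / 4)
  by_cases h : Even d
  · have hb' : ¬ Even b := by grind
    rw [if_pos h, if_neg hb', ← mul_assoc, ← zpow_one_add₀ hz]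
    congr 2
    ring
  · have hb' : Even b := by grind
    have hdo := Int.not_even_iff_odd.mp h
    rw [if_neg h, if_pos hb', ← mul_assoc, ← zpow_one_add₀ hz, neg_eq_neg_one_mul b,
      jacobiSym.mul_left, jacobiSym.at_neg_one (Int.natAbs_odd.mpr hdo)]
    obtain ⟨k, rfl⟩ := hdo
    have h4 : ((2 * k + 1).natAbs : ℤ) = 2 * k + 1 := by omega
    have hχ : ZMod.χ₄ ((2 * k + 1).natAbs : ℕ) = if Even k then 1 else -1 := by
      rw [ZMod.χ₄_nat_eq_if_mod_four]
      grind
    rw [hχ]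
    push_cast
    rw [← mul_assoc]
    congr 1
    have := exp_pi_mul_I_div_four_zpow_four_mul k
    have hsq : ((if Even k then 1 else -1 : ℤ) : ℂ) * ((if Even k then 1 else -1 : ℤ) : ℂ) = 1 := by
      split_ifs <;> simp
    rw [show (1 + -(2 * k + 1) : ℤ) = 2 * k + 1 - 1 - 4 * k by ring, zpow_sub₀ hz _ (4 * k), this]
    push_cast at hsq ⊢
    rw [eq_div_iff (left_ne_zero_of_mul_eq_one hsq), mul_assoc, hsq, mul_one]

section Moebius

variable {a b c d : ℤ} {τ : ℂ}

lemma intCast_mul_add_ne_zero (hd : d ≠ 0) (hτ : 0 < τ.im) : (c * τ + d : ℂ) ≠ 0 := by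
  intro h
  have him := congrArg Complex.im h
  have hre := congrArg Complex.re h
  simp at him hre
  rcases him with rfl | h0
  · simp [hd] at hre
  · exact hτ.ne' h0

lemma im_moebius_pos (hdet : a * d - b * c = 1) (hd : d ≠ 0) (hτ : 0 < τ.im) :
    0 < ((a * τ + b) / (c * τ + d) : ℂ).im := by
  have hj := intCast_mul_add_ne_zero (c := c) hd hτ
  have hdet' : (a * d - b * c : ℝ) = 1 := by exact_mod_cast hdet
  have : ((a * τ + b) / (c * τ + d) : ℂ).im = τ.im / Complex.normSq (c * τ + d) := by
    rw [Complex.div_im, ← sub_div]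
    congr 1
    simp
    linear_combination τ.im * hdet'
  rw [this]
  exact div_pos hτ (Complex.normSq_pos.mpr hj)

/-- For `b ≥ 0` and `d > 0` the logarithm of the numerator `a * τ + b` is the sum of those of the
quotient and of the denominator, without correction term. -/
lemma log_moebius_num (hdet : a * d - b * c = 1) (hb : 0 ≤ b) (hd : 0 < d) (hτ : 0 < τ.im) :
    Complex.log (a * τ + b) =
      Complex.log ((a * τ + b) / (c * τ + d)) + Complex.log (c * τ + d) := by
  have hj := intCast_mul_add_ne_zero (c := c) hd.ne' hτ
  have hw := im_moebius_pos hdet hd.ne' hτ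
  set w := ((a * τ + b) / (c * τ + d) : ℂ) with hwdef
  have hw0 : w ≠ 0 := by
    intro h
    simp [h] at hw
  have hnum : (a * τ + b : ℂ) = w * (c * τ + d) := (div_mul_cancel₀ _ hj).symm
  have hargw : 0 ≤ w.arg := Complex.arg_nonneg_iff.mpr hw.le
  have hargw' : w.arg < Real.pi := Complex.arg_lt_pi_iff.mpr (Or.inr hw.ne')
  have hjpi := Complex.neg_pi_lt_arg (c * τ + d)
  rcases le_or_gt c 0 with hc | hc
  · have hcr : (c : ℝ) ≤ 0 := by exact_mod_cast hc
    have : (c * τ + d : ℂ).arg ≤ 0 := by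
      rcases hc.lt_or_eq with hc | rfl
      · have hcr : (c : ℝ) < 0 := by exact_mod_cast hc
        refine (Complex.arg_neg_iff.mpr ?_).le
        simpa using mul_neg_of_neg_of_pos hcr hτ
      · rw [Int.cast_zero, zero_mul, zero_add]
        exact (Complex.arg_ofReal_of_nonneg (x := (d : ℝ)) (by exact_mod_cast hd.le)).le
    rw [hnum, (Complex.log_mul_eq_add_log_iff hw0 hj).mpr ⟨by linarith, by linarith⟩]
  · have ha : 0 < a := by
      by_contra! h
      nlinarith [mul_nonneg hb hc.le, mul_nonneg (neg_nonneg.mpr h) hd.le]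
    have har : (0 : ℝ) < a := by exact_mod_cast ha
    have hn0 : (a * τ + b : ℂ) ≠ 0 := hnum ▸ mul_ne_zero hw0 hj
    have hn : 0 ≤ (a * τ + b : ℂ).arg := by
      refine Complex.arg_nonneg_iff.mpr ?_
      simpa using (mul_pos har hτ).le
    have hn' := Complex.arg_le_pi (a * τ + b)
    have hinv : w⁻¹.arg = -w.arg := by rw [Complex.arg_inv, if_neg hargw'.ne]
    have hlinv := Complex.log_inv w hargw'.ne
    have : (c * τ + d : ℂ) = (a * τ + b) * w⁻¹ := by
      rw [hnum, mul_right_comm, mul_inv_cancel₀ hw0, one_mul]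
    rw [this, (Complex.log_mul_eq_add_log_iff hn0 (inv_ne_zero hw0)).mpr
      ⟨by linarith, by linarith⟩, hlinv]
    ring

lemma log_neg_I_mul {w : ℂ} (hw : 0 < w.im) :
    Complex.log (-I * w) = Complex.log w - Real.pi / 2 * I := by
  have hw0 : w ≠ 0 := by
    intro h
    simp [h] at hw
  have hargw : 0 ≤ w.arg := Complex.arg_nonneg_iff.mpr hw.le
  have hargw' : w.arg ≤ Real.pi := w.arg_le_pi
  rw [(Complex.log_mul_eq_add_log_iff (neg_ne_zero.mpr I_ne_zero) hw0).mpr, Complex.log_neg_I]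
  · ring
  · rw [Complex.arg_neg_I]
    constructor <;> linarith [Real.pi_pos]

lemma sqrt_moebius_num (hdet : a * d - b * c = 1) (hb : 0 ≤ b) (hd : 0 < d) (hτ : 0 < τ.im) :
    (a * τ + b : ℂ) ^ (1 / 2 : ℂ) = cexp (Real.pi * I / 4) *
      (-I * ((a * τ + b) / (c * τ + d))) ^ (1 / 2 : ℂ) * (c * τ + d) ^ (1 / 2 : ℂ) := by
  have hj := intCast_mul_add_ne_zero (c := c) hd.ne' hτ
  have hw := im_moebius_pos hdet hd.ne' hτ
  have hw0 : ((a * τ + b) / (c * τ + d) : ℂ) ≠ 0 := by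
    intro h
    simp [h] at hw
  have hn0 : (a * τ + b : ℂ) ≠ 0 := (div_ne_zero_iff.mp hw0).1
  rw [Complex.cpow_def_of_ne_zero hn0, Complex.cpow_def_of_ne_zero hj,
    Complex.cpow_def_of_ne_zero (mul_ne_zero (neg_ne_zero.mpr I_ne_zero) hw0),
    log_neg_I_mul hw, log_moebius_num hdet hb hd hτ, ← Complex.exp_add, ← Complex.exp_add]
  congr 1
  ring

/-- The transformation law of the two-variable Jacobi theta function under the matrix with rows
`(a, b)` and `(c, d)`. -/
def JacobiThetaTransforms (a b c d : ℤ) : Prop :=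
  ∀ z τ : ℂ, 0 < τ.im → jacobiTheta₂ (z / (c * τ + d)) ((a * τ + b) / (c * τ + d)) =
    upsilonMult b d 1 * (c * τ + d) ^ (1 / 2 : ℂ) *
      cexp (Real.pi * I * c * z ^ 2 / (c * τ + d)) * jacobiTheta₂ z τ

lemma jacobiTheta₂_moebius_inversion (hdet : a * d - b * c = 1) (hb : 0 ≤ b) (hd : 0 < d)
    (hτ : 0 < τ.im) (z : ℂ) :
    (a * τ + b) ^ (1 / 2 : ℂ) *
        jacobiTheta₂ (z / (c * τ + d)) ((a * τ + b) / (c * τ + d)) =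
      cexp (Real.pi * I / 4) * (c * τ + d) ^ (1 / 2 : ℂ) *
        cexp (-Real.pi * I * z ^ 2 / ((a * τ + b) * (c * τ + d))) *
        jacobiTheta₂ (z / (a * τ + b)) (-(c * τ + d) / (a * τ + b)) := by
  have hj := intCast_mul_add_ne_zero (c := c) hd.ne' hτ
  have hw := im_moebius_pos hdet hd.ne' hτ
  have hw0 : ((a * τ + b) / (c * τ + d) : ℂ) ≠ 0 := by
    intro h
    simp [h] at hw
  have hn0 : (a * τ + b : ℂ) ≠ 0 := (div_ne_zero_iff.mp hw0).1
  have hI : (-I * ((a * τ + b) / (c * τ + d))) ^ (1 / 2 : ℂ) ≠ 0 := by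
    simp [Complex.cpow_eq_zero_iff, hj, hn0]
  rw [jacobiTheta₂_functional_equation, sqrt_moebius_num hdet hb hd hτ]
  have e1 : z / (c * τ + d) / ((a * τ + b) / (c * τ + d)) = z / (a * τ + b) := by field_simp
  have e2 : -1 / ((a * τ + b) / (c * τ + d)) = -(c * τ + d) / (a * τ + b) := by field_simp
  have e3 : -Real.pi * I * (z / (c * τ + d)) ^ 2 / ((a * τ + b) / (c * τ + d)) =
      -Real.pi * I * z ^ 2 / ((a * τ + b) * (c * τ + d)) := by field_simp
  rw [e1, e2, e3]
  set s := (-I * ((a * τ + b) / (c * τ + d))) ^ (1 / 2 : ℂ)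
  linear_combination (cexp (Real.pi * I / 4) * (c * τ + d) ^ (1 / 2 : ℂ) *
    cexp (-Real.pi * I * z ^ 2 / ((a * τ + b) * (c * τ + d))) *
    jacobiTheta₂ (z / (a * τ + b)) (-(c * τ + d) / (a * τ + b))) * mul_one_div_cancel hI

namespace JacobiThetaTransforms

lemma inversion_iff (hdet : a * d - b * c = 1) (hb : 0 < b) (hd : 0 < d) (hbd : Odd (b + d)) :
    JacobiThetaTransforms a b c d ↔ JacobiThetaTransforms (-c) (-d) a b := by
  refine forall_congr' fun z ↦ forall_congr' fun τ ↦ forall_congr' fun hτ ↦ ?_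
  have hj := intCast_mul_add_ne_zero (c := c) hd.ne' hτ
  have hn := intCast_mul_add_ne_zero (c := a) hb.ne' hτ
  have hn2 : (a * τ + b : ℂ) ^ (1 / 2 : ℂ) ≠ 0 := by simp [Complex.cpow_eq_zero_iff, hn]
  have hj2 : (c * τ + d : ℂ) ^ (1 / 2 : ℂ) ≠ 0 := by simp [Complex.cpow_eq_zero_iff, hj]
  have hdet' : (a * d - b * c : ℂ) = 1 := by exact_mod_cast hdet
  have hexp : cexp (Real.pi * I * c * z ^ 2 / (c * τ + d)) =
      cexp (-Real.pi * I * z ^ 2 / ((a * τ + b) * (c * τ + d))) *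
        cexp (Real.pi * I * a * z ^ 2 / (a * τ + b)) := by
    rw [← Complex.exp_add]
    congr 1
    have hjn : a * (c * τ + d) - 1 = c * (a * τ + b) := by linear_combination hdet'
    generalize (c * τ + d : ℂ) = j at hj hjn
    generalize (a * τ + b : ℂ) = n at hn hjn
    field_simp
    linear_combination -z ^ 2 * hjn
  have hcomm : ((-c : ℤ) * τ + (-d : ℤ) : ℂ) = -(c * τ + d) := by push_cast; ring
  rw [hcomm, ← mul_right_inj' hn2, jacobiTheta₂_moebius_inversion hdet hb.le hd hτ, hexp,
    upsilonMult_eq_mul_upsilonMult_neg hd hbd]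
  rw [← mul_right_inj' (mul_ne_zero (mul_ne_zero (Complex.exp_ne_zero (Real.pi * I / 4)) hj2)
    (Complex.exp_ne_zero (-Real.pi * I * z ^ 2 / ((a * τ + b) * (c * τ + d)))))
    (b := jacobiTheta₂ (z / (a * τ + b)) _)]
  refine Eq.congr rfl ?_
  ring

lemma translation_iff (hd : 0 < d) (hbd : Odd (b + d)) :
    JacobiThetaTransforms (a + 2 * c) (b + 2 * d) c d ↔ JacobiThetaTransforms a b c d := by
  refine forall_congr' fun z ↦ forall_congr' fun τ ↦ forall_congr' fun hτ ↦ ?_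
  have hj := intCast_mul_add_ne_zero (c := c) hd.ne' hτ
  rw [upsilonMult_add_two_mul hd hbd, ← jacobiTheta₂_add_right _ ((a * τ + b) / (c * τ + d))]
  have : ((a + 2 * c : ℤ) * τ + (b + 2 * d : ℤ)) / (c * τ + d) =
      (a * τ + b) / (c * τ + d) + 2 := by
    rw [div_add' _ _ _ hj]
    congr 1
    push_cast
    ring
  rw [this]

lemma translation_mul_iff (hd : 0 < d) (hbd : Odd (b + d)) (k : ℤ) :
    JacobiThetaTransforms (a + 2 * k * c) (b + 2 * k * d) c d ↔
      JacobiThetaTransforms a b c d := by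
  have hstep (n : ℤ) : JacobiThetaTransforms (a + 2 * (n + 1) * c) (b + 2 * (n + 1) * d) c d ↔
      JacobiThetaTransforms (a + 2 * n * c) (b + 2 * n * d) c d := by
    rw [← translation_iff hd (b := b + 2 * n * d) (by grind)]
    ring_nf
  induction k using Int.induction_on with
  | zero => simp
  | succ n ih => exact (hstep _).trans ih
  | pred n ih =>
    have := hstep (-n - 1)
    rw [sub_add_cancel] at this
    exact this.symm.trans ih

lemma lower_unipotent (hc : Even c) : JacobiThetaTransforms 1 0 c 1 := by
  intro z τ hτ
  have hτ0 : τ ≠ 0 := by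
    rintro rfl
    simp at hτ
  have hj : (c * τ + 1 : ℂ) ≠ 0 := by
    simpa using intCast_mul_add_ne_zero (c := c) one_ne_zero hτ
  have hτ2 : τ ^ (1 / 2 : ℂ) ≠ 0 := by simp [Complex.cpow_eq_zero_iff, hτ0]
  have hγ := jacobiTheta₂_moebius_inversion (a := 1) (b := 0) (c := c) (d := 1)
    (by ring) le_rfl one_pos hτ z
  have hS := jacobiTheta₂_moebius_inversion (a := 1) (b := 0) (c := 0) (d := 1)
    (by ring) le_rfl one_pos hτ z
  have hper : jacobiTheta₂ (z / τ) (-(c * τ + 1) / τ) = jacobiTheta₂ (z / τ) (-1 / τ) := by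
    obtain ⟨k, rfl⟩ := hc
    have hper2 : Function.Periodic (jacobiTheta₂ (z / τ)) 2 := jacobiTheta₂_add_right _
    rw [← hper2.int_mul k (-(_) / τ)]
    congr 1
    field_simp
    push_cast
    ring
  have hυ : upsilonMult 0 1 1 = 1 := by simp [upsilonMult]
  simp only [Int.cast_one, Int.cast_zero, one_mul, zero_mul, add_zero, zero_add, div_one, mul_one,
    Complex.one_cpow] at hγ hS ⊢
  rw [hυ, one_mul, ← mul_right_inj' hτ2, hγ, hper]
  have hexp : cexp (-Real.pi * I * z ^ 2 / (τ * (c * τ + 1))) =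
      cexp (Real.pi * I * c * z ^ 2 / (c * τ + 1)) * cexp (-Real.pi * I * z ^ 2 / τ) := by
    rw [← Complex.exp_add]
    congr 1
    have hc' : (c * τ + 1) - 1 = c * τ := by ring
    generalize (c * τ + 1 : ℂ) = j at hj hc'
    field_simp
    linear_combination z ^ 2 * hc'
  rw [hexp]
  linear_combination
    (-(c * τ + 1 : ℂ) ^ (1 / 2 : ℂ) * cexp (Real.pi * I * c * z ^ 2 / (c * τ + 1))) * hS

end JacobiThetaTransforms

lemma odd_add_of_theta_group (hdet : a * d - b * c = 1)
    (hθ : (Even b ∧ Even c) ∨ (Even a ∧ Even d)) : Odd (b + d) := by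
  have h : Odd (a * d - b * c) := hdet ▸ odd_one
  rw [Int.odd_sub, Int.odd_mul, Int.even_mul] at h
  rw [Int.odd_add]
  rcases hθ with ⟨hb, hc⟩ | ⟨ha, hd⟩ <;> grind

theorem jacobiThetaTransforms_of_theta_group (hdet : a * d - b * c = 1)
    (hθ : (Even b ∧ Even c) ∨ (Even a ∧ Even d)) (hd : 0 < d) :
    JacobiThetaTransforms a b c d := by
  induction hn : d.toNat using Nat.strong_induction_on generalizing a b c d with
  | _ n ih =>
  wlog hbd : |b| ≤ d generalizing a b
  · have hodd := odd_add_of_theta_group hdet hθ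
    obtain ⟨k, hk⟩ : ∃ k : ℤ, |b + 2 * k * d| ≤ d := by
      refine ⟨-((b + d) / (2 * d)), abs_le.mpr ?_⟩
      have h1 := Int.emod_nonneg (b + d) (b := 2 * d) (by omega)
      have h2 := Int.emod_lt_of_pos (b + d) (b := 2 * d) (by omega)
      have h3 := Int.mul_ediv_add_emod (b + d) (2 * d)
      constructor <;> linarith
    rw [← JacobiThetaTransforms.translation_mul_iff hd hodd k]
    exact this (by linear_combination hdet) (by grind) hk
  have hodd := odd_add_of_theta_group hdet hθ
  have hlt : |b| < d := by
    rcases hbd.lt_or_eq with h | h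
    · exact h
    · grind
  rcases lt_trichotomy b 0 with hb | rfl | hb
  · rw [abs_of_neg hb] at hlt
    have := (JacobiThetaTransforms.inversion_iff (a := c) (b := d) (c := -a) (d := -b)
      (by linear_combination hdet) hd (by omega) (by grind)).mp
      (ih (-b).toNat (by omega) (by linear_combination hdet) (by grind) (by omega) rfl)
    simpa using this
  · have hd1 : d = 1 := Int.eq_one_of_dvd_one hd.le ⟨a, by linear_combination -hdet⟩
    subst hd1
    obtain rfl : a = 1 := by linear_combination hdet
    exact JacobiThetaTransforms.lower_unipotent (by grind)
  · rw [abs_of_pos hb] at hlt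
    exact (JacobiThetaTransforms.inversion_iff hdet hb hd hodd).mpr
      (ih b.toNat (by omega) (by linear_combination hdet) (by grind) hb rfl)

end Moebius

section ThetaPart

variable {N : ℕ} {τ : ℂ}

lemma tsum_modEq_eq {N : ℤ} (hN : N ≠ 0) (h : ℤ) (f : ℤ → ℂ) :
    ∑' n : {n : ℤ // n ≡ h [ZMOD N]}, f n = ∑' m : ℤ, f (h + N * m) := by
  let e : ℤ ≃ {n : ℤ // n ≡ h [ZMOD N]} :=
    Equiv.ofBijective (fun m ↦ ⟨h + N * m, by simp [Int.ModEq]⟩) <| by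
      refine ⟨fun m m' hm ↦ ?_, fun ⟨n, hn⟩ ↦ ?_⟩
      · simpa [hN] using congrArg Subtype.val hm
      · obtain ⟨m, hm⟩ := hn.symm.dvd
        exact ⟨m, Subtype.ext (by linear_combination -hm)⟩
  exact (e.tsum_eq fun n ↦ f n).symm

lemma exp_sq_div_eq_mul_jacobiTheta₂_term (hN : N ≠ 0) (h m : ℤ) (τ : ℂ) :
    cexp (Real.pi * I * ((h + N * m : ℤ) : ℂ) ^ 2 * τ / N) =
      cexp (Real.pi * I * h ^ 2 * τ / N) * jacobiTheta₂_term m (h * τ) (N * τ) := by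
  have hN' : (N : ℂ) ≠ 0 := by exact_mod_cast hN
  rw [jacobiTheta₂_term, ← Complex.exp_add]
  congr 1
  field_simp
  push_cast
  ring

lemma thetaPart_zero_eq (hN : N ≠ 0) (h : ℤ) (τ : ℂ) :
    thetaPart N h 0 τ = cexp (Real.pi * I * h ^ 2 * τ / N) * jacobiTheta₂ (h * τ) (N * τ) := by
  unfold thetaPart
  rw [tsum_modEq_eq (by exact_mod_cast hN) h
    (fun n ↦ (n : ℂ) ^ 0 * cexp (Real.pi * I * (n : ℂ) ^ 2 * τ / N)), jacobiTheta₂, ← tsum_mul_left]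
  refine tsum_congr fun m ↦ ?_
  rw [pow_zero, one_mul, exp_sq_div_eq_mul_jacobiTheta₂_term hN]

lemma im_natCast_mul_pos (hN : N ≠ 0) (hτ : 0 < τ.im) : 0 < (N * τ : ℂ).im := by
  simpa using mul_pos (Nat.cast_pos.mpr (Nat.pos_of_ne_zero hN)) hτ

lemma thetaPart_one_eq (hN : N ≠ 0) (h : ℤ) (hτ : 0 < τ.im) :
    thetaPart N h 1 τ = cexp (Real.pi * I * h ^ 2 * τ / N) *
      (h * jacobiTheta₂ (h * τ) (N * τ) +
        N / (2 * Real.pi * I) * jacobiTheta₂' (h * τ) (N * τ)) := by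
  have hNτ := im_natCast_mul_pos hN hτ
  unfold thetaPart
  rw [tsum_modEq_eq (by exact_mod_cast hN) h
    (fun n ↦ (n : ℂ) ^ 1 * cexp (Real.pi * I * (n : ℂ) ^ 2 * τ / N))]
  refine (tsum_congr fun m ↦ ?_).trans
    ((((hasSum_jacobiTheta₂_term (h * τ) hNτ).mul_left (h : ℂ)).add
      ((hasSum_jacobiTheta₂'_term (h * τ) hNτ).mul_left (N / (2 * Real.pi * I)))).mul_left
        (cexp (Real.pi * I * h ^ 2 * τ / N))).tsum_eq
  rw [exp_sq_div_eq_mul_jacobiTheta₂_term hN, jacobiTheta₂'_term]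
  have := Real.pi_ne_zero
  field_simp
  push_cast
  ring

lemma JacobiThetaTransforms.deriv {a b c d : ℤ} (H : JacobiThetaTransforms a b c d)
    (hdet : a * d - b * c = 1) (hd : 0 < d) (hτ : 0 < τ.im) (z : ℂ) :
    jacobiTheta₂' (z / (c * τ + d)) ((a * τ + b) / (c * τ + d)) =
      upsilonMult b d 1 * (c * τ + d) ^ (1 / 2 : ℂ) *
        cexp (Real.pi * I * c * z ^ 2 / (c * τ + d)) *
        ((c * τ + d) * jacobiTheta₂' z τ + 2 * Real.pi * I * c * z * jacobiTheta₂ z τ) := by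
  have hj := intCast_mul_add_ne_zero (c := c) hd.ne' hτ
  have hw := im_moebius_pos hdet hd.ne' hτ
  have hl := (hasDerivAt_jacobiTheta₂_fst (z / (c * τ + d)) hw).comp z
    ((hasDerivAt_id z).div_const (c * τ + d : ℂ))
  have he := (((((hasDerivAt_id z).pow 2).const_mul (Real.pi * I * c : ℂ)).div_const
    (c * τ + d : ℂ)).cexp.const_mul (upsilonMult b d 1 * (c * τ + d) ^ (1 / 2 : ℂ))).mul
    (hasDerivAt_jacobiTheta₂_fst z hτ)
  have key := hl.unique (he.congr_of_eventuallyEq (.of_forall fun z ↦ H z τ hτ))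
  rw [mul_one_div, div_eq_iff hj] at key
  rw [key]
  simp only [id_eq, Pi.pow_apply]
  generalize (c * τ + d : ℂ) = j at hj
  field_simp
  push_cast
  ring

lemma jacobiTheta₂_add_intCast (z τ : ℂ) (k : ℤ) :
    jacobiTheta₂ (z + k) τ = jacobiTheta₂ z τ := by
  have hper : Function.Periodic (jacobiTheta₂ · τ) 1 := (jacobiTheta₂_add_left · τ)
  simpa using hper.int_mul k z

lemma jacobiTheta₂'_add_intCast (z τ : ℂ) (k : ℤ) :
    jacobiTheta₂' (z + k) τ = jacobiTheta₂' z τ := by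
  have hper : Function.Periodic (jacobiTheta₂' · τ) 1 := (jacobiTheta₂'_add_left · τ)
  simpa using hper.int_mul k z

end ThetaPart

theorem thetaPart_transformation (N : ℕ) (hN : Odd N) (hNpos : 0 < N)
    (a b c d : ℤ) (hdet : a * d - b * c = 1)
    (hθ : (Even b ∧ Even c) ∨ (Even a ∧ Even d))
    (hc : (N : ℤ) ∣ c) (hd : 0 < d) (h : ℤ) (ε : ℕ) (hε : ε = 0 ∨ ε = 1)
    (τ : ℂ) (hτ : 0 < τ.im) :
    thetaPart N h ε ((a * τ + b) / (c * τ + d)) =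
      Complex.exp (Real.pi * Complex.I * (a ^ 2 * b * d * h ^ 2) / N) * upsilonMult b d N *
        (c * τ + d) ^ ((1 : ℂ) / 2 + ε) * thetaPart N (a * h) ε τ := by
  obtain ⟨c, rfl⟩ := hc
  have hN0 : N ≠ 0 := hNpos.ne'
  have hNC : (N : ℂ) ≠ 0 := by exact_mod_cast hN0
  have hNτ := im_natCast_mul_pos hN0 hτ
  have hdet1 : a * d - (b * N) * c = 1 := by linear_combination hdet
  have hw := im_moebius_pos hdet hd.ne' hτ
  have hNZ : Odd (N : ℤ) := by exact_mod_cast hN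
  have hθ1 : (Even (b * N) ∧ Even c) ∨ (Even a ∧ Even d) := by
    refine hθ.imp_left fun ⟨hb, hc⟩ ↦ ⟨hb.mul_right _, ?_⟩
    exact (Int.even_mul.mp hc).resolve_left (Int.not_even_iff_odd.mpr hNZ)
  have H := jacobiThetaTransforms_of_theta_group hdet1 hθ1 hd
  have hj := intCast_mul_add_ne_zero (c := N * c) hd.ne' hτ
  have hdetC : (a * d - b * (N * c) : ℂ) = 1 := by exact_mod_cast hdet
  have hjeq : (c * (N * τ) + d : ℂ) = (N * c : ℤ) * τ + d := by push_cast; ring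
  have hz : (h * ((a * τ + b) / ((N * c : ℤ) * τ + d)) : ℂ) =
      (h * (a * τ + b)) / (c * (N * τ) + d) := by rw [hjeq, mul_div_assoc]
  have hNw : (N * ((a * τ + b) / ((N * c : ℤ) * τ + d)) : ℂ) =
      (a * (N * τ) + (b * N : ℤ)) / (c * (N * τ) + d) := by
    rw [hjeq, mul_div_assoc']
    congr 1
    push_cast
    ring
  have hshift : (h * (a * τ + b) : ℂ) = (a * h : ℤ) * τ + (h * b : ℤ) := by push_cast; ring
  have hprefactor : cexp (Real.pi * I * h ^ 2 * ((a * τ + b) / ((N * c : ℤ) * τ + d)) / N) *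
      cexp (Real.pi * I * c * (h * (a * τ + b)) ^ 2 / ((N * c : ℤ) * τ + d)) =
      cexp (Real.pi * I * (a ^ 2 * b * d * h ^ 2) / N) *
        cexp (Real.pi * I * (a * h : ℤ) ^ 2 * τ / N) := by
    obtain ⟨k, hk⟩ : Even (a * b * b * c * h ^ 2) := by
      rcases hθ1 with ⟨-, hc⟩ | ⟨ha, -⟩
      · exact (hc.mul_left _).mul_right _
      · exact (((ha.mul_right _).mul_right _).mul_right _).mul_right _
    have hkC : (a * b * b * c * h ^ 2 : ℂ) = k + k := by exact_mod_cast hk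
    rw [← Complex.exp_add, ← Complex.exp_add, Complex.exp_eq_exp_iff_exists_int]
    refine ⟨-k, ?_⟩
    have hjn : 1 + N * c * (a * τ + b) = a * ((N * c : ℤ) * τ + d) := by
      push_cast
      linear_combination -hdetC
    have hsplit : Real.pi * I * h ^ 2 * ((a * τ + b) / ((N * c : ℤ) * τ + d)) / N +
        Real.pi * I * c * (h * (a * τ + b)) ^ 2 / ((N * c : ℤ) * τ + d) =
        Real.pi * I * h ^ 2 * (a * (a * τ + b)) / N := by
      generalize ((N * c : ℤ) * τ + d : ℂ) = j at hj hjn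
      field_simp
      linear_combination (a * τ + b) * h ^ 2 * hjn
    rw [hsplit]
    field_simp
    push_cast
    linear_combination (-a * b * h ^ 2) * hdetC - N * hkC
  rw [upsilonMult_mul_natCast]
  rcases hε with rfl | rfl
  · rw [thetaPart_zero_eq hN0, thetaPart_zero_eq hN0, hz, hNw, H _ _ hNτ, hjeq, hshift,
      jacobiTheta₂_add_intCast, ← hshift, Nat.cast_zero, add_zero]
    linear_combination (upsilonMult (b * N) d 1 * ((N * c : ℤ) * τ + d) ^ (1 / 2 : ℂ) *
      jacobiTheta₂ ((a * h : ℤ) * τ) (N * τ)) * hprefactor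
  · rw [thetaPart_one_eq hN0 _ hw, thetaPart_one_eq hN0 _ hτ, hz, hNw, H _ _ hNτ,
      H.deriv hdet1 hd hNτ, hjeq, hshift, jacobiTheta₂_add_intCast, jacobiTheta₂'_add_intCast,
      ← hshift, Nat.cast_one, Complex.cpow_add _ _ hj, Complex.cpow_one]
    have hpi : (2 * Real.pi * I : ℂ) ≠ 0 := Complex.two_pi_I_ne_zero
    have hcancel : N / (2 * Real.pi * I) * (2 * Real.pi * I) = (N : ℂ) := div_mul_cancel₀ _ hpi
    have hjn : h + N * (c * (h * (a * τ + b))) = (a * h : ℤ) * ((N * c : ℤ) * τ + d) := by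
      push_cast
      linear_combination -h * hdetC
    set j : ℂ := (N * c : ℤ) * τ + d
    set r : ℂ := N / (2 * Real.pi * I)
    set Θ := jacobiTheta₂ ((a * h : ℤ) * τ) (N * τ)
    set Θ' := jacobiTheta₂' ((a * h : ℤ) * τ) (N * τ)
    set e := cexp (Real.pi * I * h ^ 2 * ((a * τ + b) / j) / N)
    set E := cexp (Real.pi * I * c * (h * (a * τ + b)) ^ 2 / j)
    set u := upsilonMult (b * N) d 1 * j ^ (1 / 2 : ℂ)
    linear_combination (u * j * ((a * h : ℤ) * Θ + r * Θ')) * hprefactor +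
      (e * E * u * Θ) * hjn + (e * E * u * c * (h * (a * τ + b)) * Θ) * hcancel
end

section
/- For coprime integers k, d with d > 0 and kd even, the quadratic Gauss sum S_{k,d} = Σ_{n=1}^{d} e^{πikn²/d} satisfies: S_{k,d} = d^{1/2}·ζ₈^{k}·(d/|k|) if d is even (and k odd), and S_{k,d} = d^{1/2}·ζ₈^{d−1}·(−k/d) if d is odd (and k even), where (·/·) denotes the Kronecker symbol and ζ₈ = e^{πi/4}. -/
open Complex

/-- The quadratic Gauss sum `S_{k,d} = ∑_{n=1}^{d} e^{π i k n² / d}`. -/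
noncomputable def quadGaussSum (k d : ℤ) : ℂ :=
  ∑ n ∈ Finset.Icc (1 : ℤ) d, Complex.exp (Real.pi * Complex.I * k * (n : ℂ) ^ 2 / d)

open Filter Topology

section CompleteResidueSystem

/-- A sum of a `d`-periodic function over a complete residue system modulo `d`. -/
theorem sum_completeResidueSystem {M ι : Type*} [AddCommMonoid M] {d : ℕ} (hd : 0 < d)
    {f : ℤ → M} (hf : ∀ m n : ℤ, m ≡ n [ZMOD d] → f m = f n) (s : Finset ι) (g : ι → ℤ)
    (hcard : s.card = d) (hg : ∀ i ∈ s, ∀ j ∈ s, g i ≡ g j [ZMOD d] → i = j) :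
    ∑ i ∈ s, f (g i) = ∑ r : Fin d, f (r : ℕ) := by
  have hd' : (0 : ℤ) < d := by exact_mod_cast hd
  have h0 (i : ι) : 0 ≤ g i % d := Int.emod_nonneg _ hd'.ne'
  have h1 (i : ι) : g i % d < d := Int.emod_lt_of_pos _ hd'
  let φ : ι → Fin d := fun i => ⟨(g i % d).toNat, by have := h0 i; have := h1 i; omega⟩
  have hinj : Set.InjOn φ s := by
    intro i hi j hj hij
    refine hg i hi j hj ?_
    have h := congrArg Fin.val hij
    have := h0 i
    have := h0 j
    simp only [φ] at h
    show g i % d = g j % d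
    omega
  have hmaps : Set.MapsTo φ s (Finset.univ : Finset (Fin d)) := fun _ _ => by simp
  have hsurj := Finset.surjOn_of_injOn_of_card_le φ hmaps hinj (by simp [hcard])
  refine Finset.sum_nbij φ hmaps hinj hsurj fun i _ => hf _ _ ?_
  show g i % d = (((g i % d).toNat : ℕ) : ℤ) % d
  rw [Int.toNat_of_nonneg (h0 i), Int.emod_emod]

end CompleteResidueSystem

section Periodicity

theorem exp_quad_eq_of_modEq {k : ℤ} {d : ℕ} (hd : 0 < d) (heven : Even (k * d)) {m n : ℤ}
    (h : m ≡ n [ZMOD d]) :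
    cexp (Real.pi * I * k * (m : ℂ) ^ 2 / (d : ℤ)) =
      cexp (Real.pi * I * k * (n : ℂ) ^ 2 / (d : ℤ)) := by
  obtain ⟨t, ht⟩ := h.symm.dvd
  obtain ⟨u, hu⟩ := heven
  obtain rfl : m = n + d * t := by linarith
  have hd' : (d : ℂ) ≠ 0 := by exact_mod_cast hd.ne'
  have hu' : (k : ℂ) * d = u + u := by exact_mod_cast hu
  rw [Complex.exp_eq_exp_iff_exists_int]
  refine ⟨k * n * t + u * t ^ 2, ?_⟩
  push_cast
  field_simp
  linear_combination (d : ℂ) * t ^ 2 * hu'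

theorem quadGaussSum_eq_sum_fin {k : ℤ} {d : ℕ} (hd : 0 < d) (heven : Even (k * d)) :
    quadGaussSum k d =
      ∑ r : Fin d, cexp (Real.pi * I * k * (((r : ℕ) : ℤ) : ℂ) ^ 2 / (d : ℤ)) := by
  refine sum_completeResidueSystem hd (fun m n h => exp_quad_eq_of_modEq hd heven h)
    (Finset.Icc (1 : ℤ) d) id (by simp) ?_
  intro i hi j hj hij
  rw [Finset.mem_Icc] at hi hj
  obtain ⟨t, ht⟩ := hij.dvd
  simp only [id] at ht
  have h1 : t < 1 := by by_contra! h; nlinarith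
  have h2 : -1 < t := by by_contra! h; nlinarith
  obtain rfl : t = 0 := by omega
  linarith

theorem quadGaussSum_add_two_mul (k t : ℤ) {d : ℤ} (hd : 0 < d) :
    quadGaussSum (k + 2 * (d * t)) d = quadGaussSum k d := by
  refine Finset.sum_congr rfl fun n _ => ?_
  have hd' : (d : ℂ) ≠ 0 := by exact_mod_cast hd.ne'
  rw [Complex.exp_eq_exp_iff_exists_int]
  refine ⟨t * n ^ 2, ?_⟩
  push_cast
  field_simp

theorem quadGaussSum_neg (k d : ℤ) :
    quadGaussSum (-k) d = (starRingEnd ℂ) (quadGaussSum k d) := by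
  simp only [quadGaussSum, map_sum, ← Complex.exp_conj]
  refine Finset.sum_congr rfl fun n _ => ?_
  simp

/-- The Chinese remainder theorem for quadratic Gauss sums. -/
theorem quadGaussSum_mul {a b : ℕ} (ha : 0 < a) (hb : 0 < b) (hab : Nat.Coprime a b) :
    quadGaussSum 2 ((a * b : ℕ) : ℤ) =
      quadGaussSum (2 * a) b * quadGaussSum (2 * b) a := by
  have hev (x : ℤ) (c : ℕ) : Even (2 * x * c) := ⟨x * c, by ring⟩
  have hcop : IsCoprime (a : ℤ) b := Nat.isCoprime_iff_coprime.mpr hab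
  rw [quadGaussSum_eq_sum_fin hb (hev _ _), quadGaussSum_eq_sum_fin ha (hev _ _),
    quadGaussSum_eq_sum_fin (Nat.mul_pos ha hb) (by simp),
    Finset.sum_mul_sum, ← Finset.sum_product',
    ← sum_completeResidueSystem (Nat.mul_pos ha hb) (M := ℂ)
      (f := fun n => cexp (Real.pi * I * (2 : ℤ) * (n : ℂ) ^ 2 / ((a * b : ℕ) : ℤ)))
      (fun m n h => exp_quad_eq_of_modEq (Nat.mul_pos ha hb) (by simp) h)
      ((Finset.univ : Finset (Fin b)) ×ˢ (Finset.univ : Finset (Fin a)))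
      (fun x => a * (x.1 : ℕ) + b * (x.2 : ℕ)) (by simp [mul_comm])]
  · refine Finset.sum_congr rfl fun x _ => ?_
    have ha' : (a : ℂ) ≠ 0 := by exact_mod_cast ha.ne'
    have hb' : (b : ℂ) ≠ 0 := by exact_mod_cast hb.ne'
    rw [← Complex.exp_add, Complex.exp_eq_exp_iff_exists_int]
    refine ⟨2 * (x.1 : ℕ) * (x.2 : ℕ), ?_⟩
    push_cast
    field_simp
    ring
  · rintro ⟨i, j⟩ - ⟨i', j'⟩ - h
    obtain ⟨t, ht⟩ := Int.ModEq.dvd h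
    push_cast at ht
    have h1 : (b : ℤ) ∣ (i' : ℕ) - (i : ℕ) :=
      hcop.symm.dvd_of_dvd_mul_left ⟨a * t - ((j' : ℕ) - (j : ℕ)), by linear_combination ht⟩
    have h2 : (a : ℤ) ∣ (j' : ℕ) - (j : ℕ) :=
      hcop.dvd_of_dvd_mul_left ⟨b * t - ((i' : ℕ) - (i : ℕ)), by linear_combination ht⟩
    have h3 := Int.eq_zero_of_abs_lt_dvd h1 (by rw [abs_lt]; omega)
    have h4 := Int.eq_zero_of_abs_lt_dvd h2 (by rw [abs_lt]; omega)
    ext <;> simp only <;> omega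

end Periodicity
section Reciprocity

theorem ofReal_mul_cpow_half {r : ℝ} (hr : 0 < r) {z : ℂ} (hz : z ≠ 0) :
    ((r : ℂ) * z) ^ (1 / 2 : ℂ) = (Real.sqrt r : ℂ) * z ^ (1 / 2 : ℂ) := by
  have hr' : (r : ℂ) ≠ 0 := by exact_mod_cast hr.ne'
  rw [Complex.cpow_def_of_ne_zero (mul_ne_zero hr' hz), Complex.cpow_def_of_ne_zero hz,
    Complex.log_ofReal_mul hr hz, add_mul, Complex.exp_add]
  congr 1
  rw [Real.sqrt_eq_rpow, Real.rpow_def_of_pos hr]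
  push_cast
  rfl

theorem summable_exp_neg_quadratic {a : ℂ} (ha : 0 < a.re) (b : ℂ) :
    Summable fun n : ℤ => cexp (-Real.pi * a * n ^ 2 + 2 * Real.pi * b * n) := by
  have h := (summable_jacobiTheta₂_term_iff (-I * b) (I * a)).mpr (by simpa using ha)
  refine h.congr fun n => ?_
  rw [jacobiTheta₂_term]
  congr 1
  linear_combination (-2 * Real.pi * n * b + Real.pi * n ^ 2 * a) * Complex.I_sq

theorem tendsto_tsum_exp_neg_quadratic {ι : Type*} {l : Filter ι} {w : ι → ℂ}
    (hw : Tendsto (fun i => (w i).re) l atTop) (x : ℝ) :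
    Tendsto (fun i => ∑' n : ℤ, cexp (-Real.pi * w i * n ^ 2 + 2 * Real.pi * (I * x) * n)) l
      (𝓝 1) := by
  have hnorm (i : ι) (n : ℤ) :
      ‖cexp (-Real.pi * w i * n ^ 2 + 2 * Real.pi * (I * x) * n)‖ =
        Real.exp (-Real.pi * (w i).re * n ^ 2) := by
    rw [Complex.norm_exp]
    congr 1
    have : -(Real.pi : ℂ) * w i * n ^ 2 + 2 * Real.pi * (I * x) * n =
        ((-Real.pi * n ^ 2 : ℝ) : ℂ) * w i + ((2 * Real.pi * x * n : ℝ) : ℂ) * I := by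
      push_cast; ring
    rw [this, Complex.add_re, Complex.re_ofReal_mul, Complex.re_ofReal_mul]
    simp
    ring
  have hsum : Summable fun n : ℤ => Real.exp (-Real.pi * n ^ 2) := by
    refine (summable_exp_neg_quadratic (a := 1) (by simp) 0).norm.congr fun n => ?_
    rw [Complex.norm_exp]
    congr 1
    have : -(Real.pi : ℂ) * 1 * n ^ 2 + 2 * Real.pi * 0 * n = ((-Real.pi * n ^ 2 : ℝ) : ℂ) := by
      push_cast; ring
    rw [this, Complex.ofReal_re]
  have hlim := tendsto_tsum_of_dominated_convergence
    (f := fun i (n : ℤ) => cexp (-Real.pi * w i * n ^ 2 + 2 * Real.pi * (I * x) * n))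
    (g := fun n : ℤ => if n = 0 then (1 : ℂ) else 0) (𝓕 := l) hsum ?_ ?_
  · simpa using hlim
  · intro n
    by_cases hn : n = 0
    · simpa [hn] using tendsto_const_nhds
    · simp only [hn, if_false]
      rw [tendsto_zero_iff_norm_tendsto_zero]
      simp only [hnorm]
      refine Real.tendsto_exp_atBot.comp ?_
      have hn' : (0 : ℝ) < n ^ 2 := by positivity
      have hc : -Real.pi * (n : ℝ) ^ 2 < 0 := by nlinarith [Real.pi_pos]
      refine (hw.const_mul_atTop_of_neg hc).congr fun i => by ring
  · filter_upwards [hw.eventually_ge_atTop 1] with i hi n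
    rw [hnorm]
    refine Real.exp_le_exp.mpr ?_
    have : 0 ≤ Real.pi * (n : ℝ) ^ 2 := by positivity
    nlinarith

theorem tendsto_tsum_exp_residueClass {ι : Type*} {l : Filter ι} {w : ι → ℂ}
    (hw : Tendsto (fun i => (w i).re) l atTop) {d : ℕ} (hd : 0 < d) (r : ℤ) :
    Tendsto (fun i => 1 / w i ^ (1 / 2 : ℂ) *
      ∑' m : ℤ, cexp (-Real.pi / w i * ((m * d + r : ℤ) : ℂ) ^ 2)) l (𝓝 (1 / d)) := by
  have hd' : (d : ℂ) ≠ 0 := by exact_mod_cast hd.ne'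
  have hdr : (0 : ℝ) < 1 / d ^ 2 := by positivity
  have hw' : Tendsto (fun i => (((1 / d ^ 2 : ℝ) : ℂ) * w i).re) l atTop := by
    simp only [Complex.re_ofReal_mul]
    exact hw.const_mul_atTop hdr
  have h := (tendsto_tsum_exp_neg_quadratic hw' (-(r / d))).const_mul (1 / (d : ℂ))
  rw [mul_one] at h
  refine h.congr' ?_
  filter_upwards [hw.eventually_gt_atTop 0] with i hi
  have hwi : w i ≠ 0 := by rintro h; simp [h] at hi
  have hwc : w i ^ (1 / 2 : ℂ) ≠ 0 := by simp [Complex.cpow_eq_zero_iff, hwi]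
  rw [Complex.tsum_exp_neg_quadratic (by rw [Complex.re_ofReal_mul]; positivity),
    ofReal_mul_cpow_half hdr hwi, Real.sqrt_div zero_le_one, Real.sqrt_one,
    Real.sqrt_sq (Nat.cast_nonneg d), ← mul_assoc]
  congr 1
  · push_cast
    field_simp
  · refine tsum_congr fun m => ?_
    congr 1
    have hI : (m : ℂ) + I * (I * ((-(r / d) : ℝ) : ℂ)) = m + r / d := by
      push_cast
      linear_combination (-(r / d) : ℂ) * Complex.I_sq
    rw [hI]
    push_cast
    field_simp

theorem tendsto_tsum_exp_quadGaussSum {ι : Type*} {l : Filter ι} {w : ι → ℂ}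
    (hw : Tendsto (fun i => (w i).re) l atTop) {k : ℤ} {d : ℕ} (hd : 0 < d)
    (heven : Even (k * d)) :
    Tendsto (fun i => 1 / w i ^ (1 / 2 : ℂ) *
      ∑' n : ℤ, cexp (-Real.pi * (1 / w i - I * k / d) * (n : ℂ) ^ 2)) l
      (𝓝 (quadGaussSum k d / d)) := by
  have : NeZero d := ⟨hd.ne'⟩
  have hd' : (d : ℂ) ≠ 0 := by exact_mod_cast hd.ne'
  have h := tendsto_finsetSum (Finset.univ : Finset (Fin d)) fun r _ =>
    (tendsto_tsum_exp_residueClass hw hd (r : ℕ)).const_mul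
      (cexp (Real.pi * I * k * (((r : ℕ) : ℤ) : ℂ) ^ 2 / (d : ℤ)))
  rw [← Finset.sum_mul, ← quadGaussSum_eq_sum_fin hd heven, mul_one_div] at h
  refine h.congr' ?_
  filter_upwards [hw.eventually_gt_atTop 0] with i hi
  have hwi : w i ≠ 0 := by rintro h; simp [h] at hi
  have hre : 0 < (1 / w i - I * k / d).re := by
    have h1 : I * k / d = ((k / d : ℝ) : ℂ) * I := by push_cast; ring
    rw [h1, Complex.sub_re, Complex.re_ofReal_mul, one_div, Complex.inv_re]
    have := Complex.normSq_pos.mpr hwi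
    simp
    positivity
  have hs : Summable fun n : ℤ => cexp (-Real.pi * (1 / w i - I * k / d) * (n : ℂ) ^ 2) := by
    simpa using summable_exp_neg_quadratic hre 0
  rw [← (Int.divModEquiv d).symm.tsum_eq]
  have hs' := (Int.divModEquiv d).symm.summable_iff.mpr hs
  have hs'' := (Equiv.prodComm (Fin d) ℤ).summable_iff.mpr hs'
  simp only [Function.comp_def] at hs''
  rw [← (Equiv.prodComm (Fin d) ℤ).tsum_eq, hs''.tsum_prod, tsum_fintype, Finset.mul_sum]
  refine Finset.sum_congr rfl fun r _ => ?_
  rw [mul_left_comm, ← tsum_mul_left]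
  congr 1
  refine tsum_congr fun m => ?_
  have hmod : ((r : ℕ) : ℤ) ≡ m * d + ((r : ℕ) : ℤ) [ZMOD d] := by
    simp [Int.ModEq]
  rw [exp_quad_eq_of_modEq hd heven hmod, ← Complex.exp_add]
  simp only [Equiv.prodComm_apply, Prod.swap, Int.divModEquiv_symm_apply]
  congr 1
  push_cast
  ring

/-- Reciprocity for quadratic Gauss sums (the Landsberg–Schaar relation). -/
theorem quadGaussSum_reciprocity {k d : ℕ} (hk : 0 < k) (hd : 0 < d) (heven : Even (k * d)) :
    quadGaussSum k d * Real.sqrt k =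
      Real.sqrt d * cexp (Real.pi * I / 4) * quadGaussSum (-d) k := by
  have hk' : (k : ℂ) ≠ 0 := by exact_mod_cast hk.ne'
  have hd' : (d : ℂ) ≠ 0 := by exact_mod_cast hd.ne'
  set q : ℝ := k / d with hq
  have hq0 : 0 < q := by positivity
  have hqC : (q : ℂ) = k / d := by rw [hq]; push_cast; rfl
  have hqC0 : (q : ℂ) ≠ 0 := by exact_mod_cast hq0.ne'
  have hkd : Even ((k : ℤ) * d) := by exact_mod_cast heven
  have hdk : Even (-(d : ℤ) * k) := by rw [neg_mul, mul_comm]; exact hkd.neg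
  let a : ℝ → ℂ := fun x => 1 / x - I * q
  let v : ℝ → ℂ := fun x => q ^ 2 + I * q * (1 / x)
  have hv_re (x : ℝ) : (v x).re = q ^ 2 := by
    have : v x = ((q ^ 2 : ℝ) : ℂ) + ((q * (1 / x) : ℝ) : ℂ) * I := by
      simp only [v]; push_cast; ring
    rw [this]
    simp [-ofReal_mul, -ofReal_pow]
  have ha_re (x : ℝ) : (a x).re = 1 / x := by
    have : a x = ((1 / x : ℝ) : ℂ) - (q : ℂ) * I := by
      simp only [a]; push_cast; ring
    rw [this]
    simp [-ofReal_inv, -one_div, -ofReal_div]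
  have hv0 (x : ℝ) : v x ≠ 0 := fun h => by
    have := hv_re x
    rw [h, Complex.zero_re] at this
    exact (pow_pos hq0 2).ne this
  have hw₁ : Tendsto (fun x : ℝ => (x : ℂ).re) atTop atTop := tendsto_id
  have hw₂ : Tendsto (fun x : ℝ => ((x : ℂ) * v x).re) atTop atTop := by
    simp only [Complex.re_ofReal_mul, hv_re]
    exact tendsto_id.atTop_mul_const (by positivity)
  have h₁ := tendsto_tsum_exp_quadGaussSum hw₁ hd hkd
  have h₂ := tendsto_tsum_exp_quadGaussSum hw₂ hk hdk
  have hinv : Tendsto (fun x : ℝ => 1 / (x : ℂ)) atTop (𝓝 0) := by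
    have := (Complex.continuous_ofReal.tendsto 0).comp tendsto_inv_atTop_zero
    simpa [Function.comp_def] using this
  have hv : Tendsto v atTop (𝓝 (q ^ 2)) := by
    have := (hinv.const_mul (I * q)).const_add ((q : ℂ) ^ 2)
    rwa [mul_zero, add_zero] at this
  have ha : Tendsto a atTop (𝓝 (q * -I)) := by
    have := hinv.sub_const (I * q)
    rwa [show (0 : ℂ) - I * q = q * -I by ring] at this
  have hv' : Tendsto (fun x => v x ^ (1 / 2 : ℂ)) atTop (𝓝 (((q : ℂ) ^ 2) ^ (1 / 2 : ℂ))) :=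
    (continuousAt_cpow_const (Or.inl (by
      rw [← ofReal_pow, Complex.ofReal_re]; positivity))).tendsto.comp hv
  have ha' : Tendsto (fun x => a x ^ (1 / 2 : ℂ)) atTop (𝓝 (((q : ℂ) * -I) ^ (1 / 2 : ℂ))) :=
    (continuousAt_cpow_const (Or.inr (by simpa using hq0.ne'))).tendsto.comp ha
  have hlim := (hv'.div ha' (by simp [Complex.cpow_eq_zero_iff, hqC0])).mul h₂
  have heq : (fun x : ℝ => v x ^ (1 / 2 : ℂ) / a x ^ (1 / 2 : ℂ) *
      (1 / (x * v x) ^ (1 / 2 : ℂ) *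
        ∑' n : ℤ, cexp (-Real.pi * (1 / (x * v x) - I * ((-d : ℤ) : ℂ) / k) * (n : ℂ) ^ 2)))
      =ᶠ[atTop] fun x : ℝ => 1 / (x : ℂ) ^ (1 / 2 : ℂ) *
        ∑' n : ℤ, cexp (-Real.pi * (1 / x - I * ((k : ℤ) : ℂ) / d) * (n : ℂ) ^ 2) := by
    filter_upwards [eventually_gt_atTop 0] with x hx
    have hx0 : (x : ℂ) ≠ 0 := by exact_mod_cast hx.ne'
    have hax : 0 < (a x).re := by rw [ha_re]; positivity
    have ha0 : a x ≠ 0 := fun h => by simp [h] at hax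
    have e1 : 1 / (x : ℂ) - I * ((k : ℤ) : ℂ) / d = a x := by
      simp only [a, hqC]; push_cast; ring
    have hva : (x : ℂ) * v x = I * q * (x * a x) := by
      simp only [a, v]
      field_simp
      linear_combination ((x : ℂ) * q) * Complex.I_sq
    have e2 : 1 / ((x : ℂ) * v x) - I * ((-d : ℤ) : ℂ) / k = 1 / a x := by
      have : I * ((-d : ℤ) : ℂ) / k = - I / q := by
        rw [hqC]; push_cast; field_simp
      rw [this, hva]
      have hxa : (x : ℂ) * a x = 1 - I * q * x := by simp only [a]; field_simp
      clear_value a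
      field_simp
      linear_combination (x : ℂ) * a x * Complex.I_sq - hxa
    have hxx : (x : ℂ) ^ (1 / 2 : ℂ) = Real.sqrt x := by
      simpa using ofReal_mul_cpow_half hx one_ne_zero
    have hvx : v x ^ (1 / 2 : ℂ) ≠ 0 := by simp [Complex.cpow_eq_zero_iff, hv0]
    rw [e1, e2, Complex.tsum_exp_neg_mul_int_sq hax, ofReal_mul_cpow_half hx (hv0 x), hxx]
    simp only [mul_one_div]
    field_simp
  have key := tendsto_nhds_unique (hlim.congr' heq) h₁
  have hI : (-I : ℂ) ^ (1 / 2 : ℂ) = (cexp (Real.pi * I / 4))⁻¹ := by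
    rw [Complex.cpow_def_of_ne_zero (by simp), Complex.log_neg_I, ← Complex.exp_neg]
    congr 1
    ring
  have hqq : ((q : ℂ) ^ 2) ^ (1 / 2 : ℂ) = q := by
    have := ofReal_mul_cpow_half (pow_pos hq0 2) one_ne_zero
    simpa [Real.sqrt_sq hq0.le] using this
  have hsk : (Real.sqrt k : ℂ) ^ 2 = k := by
    rw [← ofReal_pow, Real.sq_sqrt (Nat.cast_nonneg k)]; simp
  have hsd : (Real.sqrt d : ℂ) ^ 2 = d := by
    rw [← ofReal_pow, Real.sq_sqrt (Nat.cast_nonneg d)]; simp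
  have hsk0 : (Real.sqrt k : ℂ) ≠ 0 := fun h => hk' (by rw [← hsk, h]; simp)
  have hsd0 : (Real.sqrt d : ℂ) ≠ 0 := fun h => hd' (by rw [← hsd, h]; simp)
  rw [hqq, ofReal_mul_cpow_half hq0 (by simp), hI, hqC, hq,
    Real.sqrt_div (Nat.cast_nonneg k), ofReal_div, ← hsk, ← hsd] at key
  field_simp at key
  rw [key, mul_comm]

end Reciprocity

section Evaluation

theorem exp_pi_mul_I_div_four_sq : cexp (Real.pi * I / 4) ^ 2 = I := by
  rw [← Complex.exp_nat_mul]
  refine Eq.trans ?_ Complex.exp_pi_div_two_mul_I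
  congr 1
  push_cast
  ring

theorem exp_pi_mul_I_div_four_mul_sqrt_two :
    cexp (Real.pi * I / 4) * Real.sqrt 2 = 1 + I := by
  have h2 : (Real.sqrt 2 : ℂ) ^ 2 = 2 := by
    rw [← ofReal_pow, Real.sq_sqrt (by norm_num)]; simp
  have h : (Real.pi : ℂ) * I / 4 = ((Real.pi / 4 : ℝ) : ℂ) * I := by push_cast; ring
  rw [h, Complex.exp_mul_I, ← Complex.ofReal_cos, ← Complex.ofReal_sin, Real.cos_pi_div_four,
    Real.sin_pi_div_four]
  push_cast
  linear_combination (1 + I) / 2 * h2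

theorem quadGaussSum_two {b : ℕ} (hb : Odd b) :
    quadGaussSum 2 b = Real.sqrt b * (if b % 4 = 1 then 1 else I) := by
  have hS : quadGaussSum (-b) 2 = (-I) ^ b + 1 := by
    have hIcc : Finset.Icc (1 : ℤ) 2 = {1, 2} := rfl
    rw [quadGaussSum, hIcc, Finset.sum_pair (by norm_num)]
    congr 1
    · rw [← Complex.exp_neg_pi_div_two_mul_I, ← Complex.exp_nat_mul]
      congr 1
      push_cast
      ring
    · rw [Complex.exp_eq_one_iff]
      refine ⟨-b, ?_⟩
      push_cast
      ring
  have hζ := exp_pi_mul_I_div_four_mul_sqrt_two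
  have h2 : (Real.sqrt 2 : ℂ) ^ 2 = 2 := by
    rw [← ofReal_pow, Real.sq_sqrt (by norm_num)]; simp
  have h := quadGaussSum_reciprocity (k := 2) two_pos hb.pos (by simp)
  simp only [Nat.cast_ofNat] at h
  rw [hS] at h
  have hval : (1 + I) * ((-I) ^ b + 1) = 2 * (if b % 4 = 1 then 1 else I) := by
    have h4 : (-I) ^ 4 = (1 : ℂ) := by rw [neg_pow, Complex.I_pow_four]; norm_num
    have hb4 : (-I) ^ b = (-I) ^ (b % 4) := by
      conv_lhs => rw [← Nat.div_add_mod b 4, pow_add, pow_mul, h4, one_pow, one_mul]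
    rw [hb4]
    have : b % 4 = 1 ∨ b % 4 = 3 := by obtain ⟨m, rfl⟩ := hb; omega
    rcases this with h1 | h3
    · simp only [h1, if_true]
      linear_combination -Complex.I_sq
    · simp only [h3]
      norm_num
      linear_combination (-I ^ 2 - I + 1) * Complex.I_sq
  linear_combination Real.sqrt 2 / 2 * h + (Real.sqrt b * ((-I) ^ b + 1) / 2) * hζ +
    Real.sqrt b / 2 * hval - quadGaussSum 2 b / 2 * h2

theorem quadGaussSum_one_right {k : ℤ} (hk : Even k) : quadGaussSum k 1 = 1 := by
  obtain ⟨m, rfl⟩ := hk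
  rw [quadGaussSum, Finset.Icc_self, Finset.sum_singleton, Complex.exp_eq_one_iff]
  refine ⟨m, ?_⟩
  push_cast
  ring

theorem jacobiSym_mul_jacobiSym_mul_ite {a b : ℕ} (ha : Odd a) (hb : Odd b)
    (hab : Nat.Coprime a b) :
    ((jacobiSym a b : ℤ) : ℂ) * jacobiSym b a *
        ((if a % 4 = 1 then 1 else I) * (if b % 4 = 1 then 1 else I)) =
      if (a * b) % 4 = 1 then 1 else I := by
  have hsq : ((jacobiSym b a : ℤ) : ℂ) ^ 2 = 1 := by
    exact_mod_cast jacobiSym.sq_one (by simpa using hab.symm)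
  have ha4 : a % 4 = 1 ∨ a % 4 = 3 := by obtain ⟨m, rfl⟩ := ha; omega
  have hb4 : b % 4 = 1 ∨ b % 4 = 3 := by obtain ⟨m, rfl⟩ := hb; omega
  rcases ha4 with h1 | h1 <;> rcases hb4 with h2 | h2
  · rw [jacobiSym.quadratic_reciprocity_one_mod_four h1 hb]
    simp [Nat.mul_mod, h1, h2, ← sq, hsq]
  · rw [jacobiSym.quadratic_reciprocity_one_mod_four h1 hb]
    simp [Nat.mul_mod, h1, h2, ← sq, hsq]
  · rw [jacobiSym.quadratic_reciprocity_one_mod_four' ha h2]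
    simp [Nat.mul_mod, h1, h2, ← sq, hsq]
  · rw [jacobiSym.quadratic_reciprocity_three_mod_four h1 h2]
    simp [Nat.mul_mod, h1, h2, ← sq, hsq]

theorem exists_odd_modEq_abs_lt {b : ℕ} (hb : Odd b) {a : ℤ} (hab : ¬ (b : ℤ) ∣ a) :
    ∃ a' t : ℤ, Odd a' ∧ a'.natAbs < b ∧ a = a' + b * t := by
  have hb0 : (0 : ℤ) < b := by exact_mod_cast hb.pos
  have h0 := Int.emod_nonneg a hb0.ne'
  have h1 := Int.emod_lt_of_pos a hb0
  have h2 := Int.emod_add_mul_ediv a b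
  have h3 : a % b ≠ 0 := fun h => hab (Int.dvd_of_emod_eq_zero h)
  obtain ⟨m, hm⟩ := hb
  by_cases hodd : Odd (a % b)
  · exact ⟨a % b, a / b, hodd, by omega, h2.symm⟩
  · refine ⟨a % b - b, a / b + 1, ?_, ?_, by linarith⟩
    · rw [Int.not_odd_iff_even] at hodd
      exact hodd.sub_odd ⟨m, by exact_mod_cast hm⟩
    · omega

theorem quadGaussSum_two_mul {b : ℕ} (hb : Odd b) {a : ℤ} (hab : IsCoprime a b) :
    quadGaussSum (2 * a) b = jacobiSym a b * quadGaussSum 2 b := by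
  induction b using Nat.strong_induction_on generalizing a with
  | _ b ih =>
  by_cases hb1 : b = 1
  · subst hb1
    simp [quadGaussSum_one_right]
  have hb0 : (0 : ℤ) < b := by exact_mod_cast hb.pos
  have hpos {c : ℕ} (hc : Odd c) (hcb : c < b) (hcop : Nat.Coprime c b) :
      quadGaussSum (2 * c) b = jacobiSym c b * quadGaussSum 2 b := by
    have h1 := quadGaussSum_mul hc.pos hb.pos hcop
    rw [ih c hcb hc (Nat.isCoprime_iff_coprime.mpr hcop.symm), quadGaussSum_two hc,
      quadGaussSum_two (hc.mul hb), ← jacobiSym_mul_jacobiSym_mul_ite hc hb hcop] at h1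
    rw [quadGaussSum_two hb]
    have hJ : ((jacobiSym b c : ℤ) : ℂ) ≠ 0 := by
      exact_mod_cast jacobiSym.ne_zero (by simpa using hcop.symm)
    have hs : (Real.sqrt c : ℂ) ≠ 0 := by
      have := hc.pos
      exact_mod_cast (by positivity : Real.sqrt c ≠ 0)
    have hε : (if c % 4 = 1 then 1 else I : ℂ) ≠ 0 := by split_ifs <;> simp
    rw [Nat.cast_mul, Real.sqrt_mul (Nat.cast_nonneg c)] at h1
    push_cast at h1
    refine mul_right_cancel₀ (mul_ne_zero (mul_ne_zero hJ hs) hε) ?_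
    linear_combination -h1
  have hndvd : ¬ (b : ℤ) ∣ a := fun h => hb1 <| by
    simpa using Int.isUnit_iff_natAbs_eq.mp (hab.isUnit_of_dvd' h dvd_rfl)
  obtain ⟨a', t, ha', hlt, rfl⟩ := exists_odd_modEq_abs_lt hb hndvd
  have hcop : Nat.Coprime a'.natAbs b :=
    Int.isCoprime_iff_gcd_eq_one.mp hab.of_add_mul_left_left
  have hJ : jacobiSym (a' + b * t) b = jacobiSym a' b :=
    jacobiSym.mod_left' (by simp)
  rw [hJ, mul_add, quadGaussSum_add_two_mul _ _ hb0]
  have hp := hpos (Int.natAbs_odd.mpr ha') hlt hcop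
  rcases Int.natAbs_eq a' with h | h
  · rw [← h] at hp
    exact hp
  · rw [h, mul_neg, quadGaussSum_neg, hp, jacobiSym.neg _ hb, map_mul, quadGaussSum_two hb,
      ZMod.χ₄_nat_eq_if_mod_four]
    have : b % 4 = 1 ∨ b % 4 = 3 := by obtain ⟨m, rfl⟩ := hb; omega
    have hb2 : b % 2 = 1 := Nat.odd_iff.mp hb
    rcases this with h1 | h1 <;> simp [h1, hb2]

theorem quadGaussSum_odd {k : ℤ} {d : ℕ} (hd : Odd d) (hk : Even k) (hcop : IsCoprime k d) :
    quadGaussSum k d =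
      Real.sqrt d * cexp (Real.pi * I / 4) ^ ((d : ℤ) - 1) * jacobiSym (-k) d := by
  obtain ⟨a, rfl⟩ := hk
  rw [← two_mul] at hcop ⊢
  rw [quadGaussSum_two_mul hd hcop.of_mul_left_right, quadGaussSum_two hd, ← neg_mul,
    jacobiSym.mul_left, jacobiSym.at_neg_two hd]
  have hζ := exp_pi_mul_I_div_four_sq
  set ζ := cexp (Real.pi * I / 4)
  have hpow : ζ ^ ((d : ℤ) - 1) * (ZMod.χ₈' d : ℤ) = if d % 4 = 1 then 1 else I := by
    obtain ⟨m, rfl⟩ := hd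
    rw [show ((2 * m + 1 : ℕ) : ℤ) - 1 = (2 * m : ℕ) by push_cast; ring, zpow_natCast, pow_mul, hζ,
      ← Nat.div_add_mod m 4, pow_add, pow_mul, Complex.I_pow_four, one_pow, one_mul,
      ZMod.χ₈'_nat_eq_if_mod_eight, Nat.div_add_mod]
    have : m % 4 = 0 ∨ m % 4 = 1 ∨ m % 4 = 2 ∨ m % 4 = 3 := by omega
    have h2 : (2 * m + 1) % 2 = 1 := by omega
    rcases this with h | h | h | h
    · have h8 : (2 * m + 1) % 8 = 1 := by omega
      have h4 : (2 * m + 1) % 4 = 1 := by omega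
      simp [h, h8, h4, h2]
    · have h8 : (2 * m + 1) % 8 = 3 := by omega
      have h4 : (2 * m + 1) % 4 = 3 := by omega
      simp [h, h8, h4, h2]
    · have h8 : (2 * m + 1) % 8 = 5 := by omega
      have h4 : (2 * m + 1) % 4 = 1 := by omega
      simp [h, h8, h4, h2]
    · have h8 : (2 * m + 1) % 8 = 7 := by omega
      have h4 : (2 * m + 1) % 4 = 3 := by omega
      simp [h, h8, h4, h2]
  rw [← hpow]
  push_cast
  ring

theorem quadGaussSum_even_of_pos {k d : ℕ} (hk : Odd k) (hd0 : 0 < d) (hd : Even d)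
    (hcop : Nat.Coprime k d) :
    quadGaussSum k d = Real.sqrt d * cexp (Real.pi * I / 4) ^ k * jacobiSym d k := by
  have h := quadGaussSum_reciprocity hk.pos hd0 (hd.mul_left k)
  rw [quadGaussSum_odd hk (by simpa using hd)
    (Nat.isCoprime_iff_coprime.mpr hcop).symm.neg_left, neg_neg,
    zpow_sub_one₀ (Complex.exp_ne_zero _), zpow_natCast] at h
  have hs : (Real.sqrt k : ℂ) ≠ 0 := by
    have := hk.pos
    exact_mod_cast (by positivity : Real.sqrt k ≠ 0)
  refine mul_right_cancel₀ hs (h.trans ?_)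
  have := Complex.exp_ne_zero (Real.pi * I / 4)
  field_simp

end Evaluation

theorem quadGaussSum_eval (k d : ℤ) (hd : 0 < d) (hcop : IsCoprime k d)
    (heven : Even (k * d)) :
    (Even d →
      quadGaussSum k d =
        (Real.sqrt d : ℂ) * Complex.exp (Real.pi * Complex.I / 4) ^ k *
          ((jacobiSym d k.natAbs : ℤ) : ℂ)) ∧
    (Odd d →
      quadGaussSum k d =
        (Real.sqrt d : ℂ) * Complex.exp (Real.pi * Complex.I / 4) ^ (d - 1) *
          ((jacobiSym (-k) d.natAbs : ℤ) : ℂ)) := by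
  lift d to ℕ using hd.le
  rw [Int.cast_natCast, Int.natAbs_natCast]
  refine ⟨fun h => ?_, fun h => ?_⟩
  · have hd' : Even d := by exact_mod_cast h
    have hk : Odd k := by
      rw [← Int.not_even_iff_odd]
      intro hk
      have := hcop.isUnit_of_dvd' hk.two_dvd h.two_dvd
      simp [Int.isUnit_iff] at this
    have hcop' : Nat.Coprime k.natAbs d :=
      Int.isCoprime_iff_gcd_eq_one.mp hcop
    have hp := quadGaussSum_even_of_pos (Int.natAbs_odd.mpr hk) (by exact_mod_cast hd) hd' hcop'
    rcases Int.natAbs_eq k with hk' | hk'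
    · rw [← zpow_natCast, ← hk'] at hp
      exact hp
    · conv_lhs => rw [hk', quadGaussSum_neg, hp]
      conv_rhs => rw [hk', zpow_neg, Int.natAbs_neg, Int.natAbs_natCast, zpow_natCast]
      simp only [map_mul, map_pow, Complex.conj_ofReal, map_intCast, ← Complex.exp_conj]
      rw [← inv_pow, ← Complex.exp_neg]
      simp [Complex.conj_ofNat, neg_div]
  · have hd' : Odd d := by exact_mod_cast h
    exact quadGaussSum_odd hd' ((Int.even_mul.mp heven).resolve_right
      (Int.not_even_iff_odd.mpr h)) hcop
end
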